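/- Let Φ = {φ_e}_{e∈ℕ} be a CIFS on X indexed by the natural numbers, and for every b ∈ ℕ let L_b = {b+1, b+2, …}. If for every b ∈ ℕ, every F ⊆ {1, 2, …, b−1} and every t with 0 < t ≤ dim_H(J_ℕ) one has λ_{F∪{b}}(t) ≤ λ_{F∪L_b}(t), then Φ has full Hausdorff dimension spectrum: for every real t with 0 ≤ t ≤ dim_H(J_ℕ) there exists F ⊆ ℕ with dim_H(J_F) = t. -/

import Mathlib

open scoped ENNReal

/-- A one-dimensional conformal iterated function system (CIFS) on a nondegenerate compact
interval `X ⊂ ℝ` with countable alphabet `E`: injective contractions `φ e : X → X` with a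
common contraction ratio `s < 1`, extending to C¹ maps with nowhere-vanishing derivative on
a fixed open interval `W ⊃ X`, satisfying the open set condition and a Hölder distortion
condition on the derivatives. -/
structure CIFS (E : Type*) where
  X : Set ℝ
  hX : ∃ a b : ℝ, a < b ∧ X = Set.Icc a b
  W : Set ℝ
  hWopen : IsOpen W
  hWconn : W.OrdConnected
  hXW : X ⊆ W
  φ : E → ℝ → ℝ
  s : ℝ
  hs0 : 0 ≤ s
  hs1 : s < 1
  maps : ∀ e, Set.MapsTo (φ e) X X
  inj : ∀ e, Set.InjOn (φ e) X
  contract : ∀ e, ∀ x ∈ X, ∀ y ∈ X, |φ e x - φ e y| ≤ s * |x - y|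
  smooth : ∀ e, ContDiffOn ℝ 1 (φ e) W
  deriv_ne : ∀ e, ∀ x ∈ W, deriv (φ e) x ≠ 0
  osc : ∀ e f, e ≠ f → Disjoint (φ e '' interior X) (φ f '' interior X)
  L : ℝ
  hL : 1 ≤ L
  β : ℝ
  hβ : 0 < β
  holder : ∀ e, ∀ x ∈ W, ∀ y ∈ W,
    ‖|deriv (φ e) y| - |deriv (φ e) x|‖ ≤ L * (⨅ z : W, |deriv (φ e) z|) * |y - x| ^ β

namespace CIFS

variable {E : Type*} (S : CIFS E)

/-- The map `φ_ω = φ_{ω_1} ∘ ⋯ ∘ φ_{ω_n}` coded by a finite word `ω`. -/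
noncomputable def wordMap (w : List E) : ℝ → ℝ :=
  w.foldr (fun e f => S.φ e ∘ f) id

/-- `‖φ'_ω‖ = sup_{x ∈ X} |φ'_ω(x)|`. -/
noncomputable def wnorm (w : List E) : ℝ :=
  ⨆ x : S.X, |deriv (S.wordMap w) x|

/-- `Z_{n,F}(t) = Σ_{ω ∈ F^n} ‖φ'_ω‖^t ∈ [0,∞]`. -/
noncomputable def Z (F : Set E) (t : ℝ) (n : ℕ) : ℝ≥0∞ :=
  ∑' w : {w : List E // w.length = n ∧ ∀ e ∈ w, e ∈ F}, ENNReal.ofReal (S.wnorm w ^ t)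

/-- `λ_F(t) = lim_n Z_{n,F}(t)^{1/n}` (the limit exists by submultiplicativity, so it
coincides with the limit superior used here). -/
noncomputable def lam (F : Set E) (t : ℝ) : ℝ≥0∞ :=
  Filter.atTop.limsup fun n : ℕ => (S.Z F t n) ^ ((n : ℝ)⁻¹)

/-- The limit set `J_F = ∪_{ω ∈ F^ℕ} ∩_{n ≥ 1} φ_{ω_1⋯ω_n}(X)`. -/
noncomputable def limitSet (F : Set E) : Set ℝ :=
  {x | ∃ ω : ℕ → E, (∀ k, ω k ∈ F) ∧
    ∀ n, 1 ≤ n → x ∈ S.wordMap ((List.range n).map ω) '' S.X}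

end CIFS

section

open Set MeasureTheory Filter Topology
open scoped ENNReal NNReal

theorem exists_offset_cover {ι : Type*} (p : ι → ℝ) (hp : ∀ i, 0 < p i) (s : Finset ι) :
    ∃ q : ι → ℝ, ∀ y ∈ Ico 0 (∑ i ∈ s, p i),
      ∃ i, ∃ z ∈ Ico (0 : ℝ) 1, y = q i + p i * z := by
  classical
  suffices H : ∃ q : ι → ℝ, ∀ y ∈ Ico 0 (∑ i ∈ s, p i),
      ∃ i ∈ s, ∃ z ∈ Ico (0 : ℝ) 1, y = q i + p i * z by
    obtain ⟨q, hq⟩ := H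
    exact ⟨q, fun y hy => let ⟨i, _, h⟩ := hq y hy; ⟨i, h⟩⟩
  induction s using Finset.induction_on with
  | empty => exact ⟨0, fun y hy => by simp at hy⟩
  | insert a s has ih =>
    obtain ⟨q, hq⟩ := ih
    refine ⟨Function.update q a (∑ i ∈ s, p i), fun y hy => ?_⟩
    rw [Finset.sum_insert has] at hy
    rcases lt_or_ge y (∑ i ∈ s, p i) with h | h
    · obtain ⟨i, hi, z, hz, e⟩ := hq y ⟨hy.1, h⟩
      have hne : i ≠ a := fun h => has (h ▸ hi)
      exact ⟨i, Finset.mem_insert_of_mem hi, z, hz, by simpa [hne] using e⟩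
    · refine ⟨a, Finset.mem_insert_self _ _, (y - ∑ i ∈ s, p i) / p a, ⟨?_, ?_⟩, ?_⟩
      · exact div_nonneg (by linarith) (hp a).le
      · rw [div_lt_one (hp a)]; linarith [hy.2]
      · rw [Function.update_self, mul_div_cancel₀ _ (hp a).ne']; ring

/-- If `|y - y'| ≤ C |g y - g y'| ^ t` on `[0, 1)`, then the image of `g` has dimension at
least `t`. -/
theorem le_dimH_image_Ico (g : ℝ → ℝ) {C t : ℝ} (ht : 0 < t) (hC : 0 ≤ C)
    (h : ∀ y ∈ Ico (0 : ℝ) 1, ∀ y' ∈ Ico (0 : ℝ) 1, |y - y'| ≤ C * |g y - g y'| ^ t) :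
    ENNReal.ofReal t ≤ dimH (g '' Ico 0 1) := by
  have hinj : InjOn g (Ico 0 1) := fun y hy y' hy' e => by
    have := h y hy y' hy'
    rw [e, sub_self, abs_zero, Real.zero_rpow ht.ne', mul_zero] at this
    exact sub_eq_zero.1 (abs_eq_zero.1 (le_antisymm this (abs_nonneg _)))
  set k := Function.invFunOn g (Ico (0 : ℝ) 1) with hk
  have hkg : ∀ y ∈ Ico (0 : ℝ) 1, k (g y) = y := fun y hy => hinj.leftInvOn_invFunOn hy
  have hH : HolderOnWith C.toNNReal t.toNNReal k (g '' Ico 0 1) := by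
    rintro _ ⟨y, hy, rfl⟩ _ ⟨y', hy', rfl⟩
    rw [hkg y hy, hkg y' hy', edist_dist, edist_dist, Real.dist_eq, Real.dist_eq,
      Real.coe_toNNReal _ ht.le, ENNReal.ofReal_rpow_of_nonneg (abs_nonneg _) ht.le]
    change _ ≤ ENNReal.ofReal C * _
    rw [← ENNReal.ofReal_mul hC]
    exact ENNReal.ofReal_le_ofReal (h y hy y' hy')
  have himg : k '' (g '' Ico 0 1) = Ico 0 1 := by
    rw [image_image]
    exact (image_congr hkg).trans (image_id' _)
  have h1 : dimH (Ico (0 : ℝ) 1) = 1 := by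
    have : (interior (Ico (0 : ℝ) 1)).Nonempty := by
      rw [interior_Ico]; exact ⟨1 / 2, by norm_num, by norm_num⟩
    rw [Real.dimH_of_nonempty_interior this, Module.finrank_self, Nat.cast_one]
  have := hH.dimH_image_le (by simpa using ht)
  rw [himg, h1] at this
  change (1 : ℝ≥0∞) ≤ _ / ENNReal.ofReal t at this
  rwa [ENNReal.le_div_iff_mul_le (by simp [ht]) (by simp), one_mul] at this

/-- Lower dimension bound for a finite iterated function system with separated images and
lower Lipschitz constants `c i` satisfying `1 ≤ ∑ i, c i ^ t`. -/
theorem exists_invariant_le_dimH {ι : Type*} [Fintype ι] {X : Set ℝ} (hX : IsClosed X)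
    {x₀ D : ℝ} (hx₀ : x₀ ∈ X) (hD : ∀ x ∈ X, ∀ y ∈ X, |x - y| ≤ D) (f : ι → ℝ → ℝ)
    (hf : ∀ i, MapsTo (f i) X X) {s : ℝ} (hs0 : 0 ≤ s) (hs1 : s < 1)
    (hlip : ∀ i, ∀ x ∈ X, ∀ y ∈ X, |f i x - f i y| ≤ s * |x - y|) (c : ι → ℝ)
    (hc : ∀ i, 0 < c i) (hc1 : ∀ i, c i < 1)
    (hlow : ∀ i, ∀ x ∈ X, ∀ y ∈ X, c i * |x - y| ≤ |f i x - f i y|) {δ : ℝ} (hδ : 0 < δ)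
    (hsep : ∀ i j, i ≠ j → ∀ x ∈ X, ∀ y ∈ X, δ ≤ |f i x - f j y|) {t : ℝ} (ht : 0 < t)
    (hsum : 1 ≤ ∑ i, c i ^ t) :
    ∃ T ⊆ X, ENNReal.ofReal t ≤ dimH T ∧ ∀ x ∈ T, ∃ i, ∃ y ∈ T, x = f i y := by
  classical
  have hsum0 : 0 < ∑ i, c i ^ t := by linarith
  set p : ι → ℝ := fun i => c i ^ t / ∑ j, c j ^ t with hp
  have hp0 : ∀ i, 0 < p i := fun i => div_pos (Real.rpow_pos_of_pos (hc i) t) hsum0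
  have hpc : ∀ i, p i ≤ c i ^ t := fun i =>
    div_le_self (Real.rpow_pos_of_pos (hc i) t).le hsum
  have hp1 : ∑ i, p i = 1 := by
    rw [hp, ← Finset.sum_div, div_self hsum0.ne']
  obtain ⟨q, hq⟩ := exists_offset_cover p hp0 Finset.univ
  rw [hp1] at hq
  have hne : Nonempty ι := let ⟨i, _⟩ := hq 0 (by simp); ⟨i⟩
  obtain ⟨ρ, hρ0, hρ1, hρ⟩ : ∃ ρ : ℝ, 0 ≤ ρ ∧ ρ < 1 ∧ ∀ i, p i ≤ ρ := by
    obtain ⟨i, hi⟩ := Finite.exists_max p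
    exact ⟨p i, (hp0 i).le, (hpc i).trans_lt (Real.rpow_lt_one (hc i).le (hc1 i) ht), hi⟩
  choose! dg tl htl hdec using hq
  -- the coding map is the limit of the approximations `g n`
  let g : ℕ → ℝ → ℝ := fun n => n.rec (fun _ => x₀) (fun _ G y => f (dg y) (G (tl y)))
  have hgX : ∀ n, ∀ y, g n y ∈ X := fun n => by
    induction n with
    | zero => exact fun _ => hx₀
    | succ n ih => exact fun y => hf _ (ih _)
  have hgc : ∀ n, ∀ y, dist (g n y) (g (n + 1) y) ≤ D * s ^ n := fun n => by
    induction n with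
    | zero => intro y; simpa [Real.dist_eq] using hD _ (hgX 0 y) _ (hgX 1 y)
    | succ n ih =>
      intro y
      calc dist (g (n + 1) y) (g (n + 2) y)
          ≤ s * dist (g n (tl y)) (g (n + 1) (tl y)) :=
            hlip _ _ (hgX n _) _ (hgX (n + 1) _)
        _ ≤ s * (D * s ^ n) := by gcongr; exact ih _
        _ = D * s ^ (n + 1) := by ring
  have hlim : ∀ y, ∃ l, Tendsto (fun n => g n y) atTop (𝓝 l) := fun y =>
    cauchySeq_tendsto_of_complete (cauchySeq_of_le_geometric s D hs1 fun n => hgc n y)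
  choose G hG using hlim
  have hGX : ∀ y, G y ∈ X := fun y =>
    hX.mem_of_tendsto (hG y) (Eventually.of_forall fun n => hgX n y)
  have hGf : ∀ y, G y = f (dg y) (G (tl y)) := fun y => by
    refine tendsto_nhds_unique ((tendsto_add_atTop_iff_nat 1).2 (hG y)) ?_
    refine tendsto_iff_dist_tendsto_zero.2 (squeeze_zero (fun _ => dist_nonneg)
      (fun n => hlip (dg y) _ (hgX n (tl y)) _ (hGX (tl y))) ?_)
    have := (tendsto_iff_dist_tendsto_zero.1 (hG (tl y))).const_mul s
    simpa [Real.dist_eq] using this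
  have hholder : ∀ n : ℕ, ∀ y ∈ Ico (0 : ℝ) 1, ∀ y' ∈ Ico (0 : ℝ) 1,
      |y - y'| ≤ (δ⁻¹) ^ t * |G y - G y'| ^ t + ρ ^ n := fun n => by
    induction n with
    | zero =>
      intro y hy y' hy'
      have : |y - y'| ≤ 1 := abs_le.2 ⟨by linarith [hy.1, hy'.2], by linarith [hy.2, hy'.1]⟩
      rw [pow_zero]
      have : 0 ≤ (δ⁻¹) ^ t * |G y - G y'| ^ t := by positivity
      linarith
    | succ n ih =>
      intro y hy y' hy'
      by_cases hd : dg y = dg y'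
      · have e : y - y' = p (dg y) * (tl y - tl y') := by
          have e1 := hdec y hy
          have e2 := hdec y' hy'
          rw [← hd] at e2
          linear_combination e1 - e2
        have hGl := hlow (dg y) _ (hGX (tl y)) _ (hGX (tl y'))
        have e3 : |G y - G y'| = |f (dg y) (G (tl y)) - f (dg y) (G (tl y'))| := by
          rw [hGf y, hGf y', ← hd]
        rw [← e3] at hGl
        have h1 : c (dg y) ^ t * |G (tl y) - G (tl y')| ^ t ≤ |G y - G y'| ^ t := by
          rw [← Real.mul_rpow (hc _).le (abs_nonneg _)]
          exact Real.rpow_le_rpow (mul_nonneg (hc _).le (abs_nonneg _)) hGl ht.le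
        rw [e, abs_mul, abs_of_pos (hp0 _)]
        calc p (dg y) * |tl y - tl y'|
            ≤ p (dg y) * ((δ⁻¹) ^ t * |G (tl y) - G (tl y')| ^ t + ρ ^ n) :=
              mul_le_mul_of_nonneg_left (ih _ (htl y hy) _ (htl y' hy')) (hp0 _).le
          _ = (δ⁻¹) ^ t * (p (dg y) * |G (tl y) - G (tl y')| ^ t) + p (dg y) * ρ ^ n := by ring
          _ ≤ (δ⁻¹) ^ t * (c (dg y) ^ t * |G (tl y) - G (tl y')| ^ t) + ρ * ρ ^ n := by
              gcongr
              · exact hpc _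
              · exact hρ _
          _ ≤ (δ⁻¹) ^ t * |G y - G y'| ^ t + ρ ^ (n + 1) := by
              rw [pow_succ' ρ n]; gcongr
      · have h1 : δ ≤ |G y - G y'| := by
          rw [hGf y, hGf y']
          exact hsep _ _ hd _ (hGX _) _ (hGX _)
        have h2 : 1 ≤ (δ⁻¹) ^ t * |G y - G y'| ^ t := by
          rw [← Real.mul_rpow (by positivity) (abs_nonneg _)]
          refine Real.one_le_rpow ?_ ht.le
          rw [inv_mul_eq_div, one_le_div hδ]
          exact h1
        have h3 : |y - y'| ≤ 1 := abs_le.2 ⟨by linarith [hy.1, hy'.2], by linarith [hy.2, hy'.1]⟩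
        have : 0 ≤ ρ ^ (n + 1) := by positivity
        linarith
  refine ⟨G '' Ico 0 1, ?_, ?_, ?_⟩
  · rintro _ ⟨y, _, rfl⟩
    exact hGX y
  · refine le_dimH_image_Ico G ht (C := (δ⁻¹) ^ t) (by positivity) fun y hy y' hy' => ?_
    have hl : Tendsto (fun n : ℕ => (δ⁻¹) ^ t * |G y - G y'| ^ t + ρ ^ n) atTop
        (𝓝 ((δ⁻¹) ^ t * |G y - G y'| ^ t + 0)) :=
      (tendsto_pow_atTop_nhds_zero_of_lt_one hρ0 hρ1).const_add _
    rw [add_zero] at hl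
    exact ge_of_tendsto' hl fun n => hholder n y hy y' hy'
  · rintro _ ⟨y, hy, rfl⟩
    exact ⟨dg y, _, ⟨tl y, htl y hy, rfl⟩, hGf y⟩

namespace CIFS

variable {E : Type*} (S : CIFS E)

/-- The left endpoint of the phase space. -/
noncomputable def lo : ℝ := S.hX.choose

/-- The right endpoint of the phase space. -/
noncomputable def hi : ℝ := S.hX.choose_spec.choose

theorem lo_lt_hi : S.lo < S.hi := S.hX.choose_spec.choose_spec.1

theorem X_eq : S.X = Icc S.lo S.hi := S.hX.choose_spec.choose_spec.2

theorem interior_X : interior S.X = Ioo S.lo S.hi := by rw [S.X_eq, interior_Icc]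

theorem lo_mem : S.lo ∈ S.X := by rw [S.X_eq]; exact left_mem_Icc.2 S.lo_lt_hi.le

theorem hi_mem : S.hi ∈ S.X := by rw [S.X_eq]; exact right_mem_Icc.2 S.lo_lt_hi.le

theorem abs_sub_le {x y : ℝ} (hx : x ∈ S.X) (hy : y ∈ S.X) : |x - y| ≤ S.hi - S.lo := by
  rw [S.X_eq] at hx hy
  exact abs_le.2 ⟨by linarith [hx.1, hy.2], by linarith [hx.2, hy.1]⟩

theorem wordMap_nil : S.wordMap [] = id := rfl

theorem wordMap_cons (e : E) (w : List E) : S.wordMap (e :: w) = S.φ e ∘ S.wordMap w := rfl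

theorem wordMap_append (u v : List E) : S.wordMap (u ++ v) = S.wordMap u ∘ S.wordMap v := by
  induction u with
  | nil => rfl
  | cons e u ih => rw [List.cons_append, wordMap_cons, wordMap_cons, ih, Function.comp_assoc]

theorem mapsTo_wordMap (w : List E) : MapsTo (S.wordMap w) S.X S.X := by
  induction w with
  | nil => exact fun x hx => hx
  | cons e w ih => exact (S.maps e).comp ih

theorem differentiableAt_φ (e : E) {x : ℝ} (hx : x ∈ S.X) : DifferentiableAt ℝ (S.φ e) x :=
  ((S.smooth e).differentiableOn one_ne_zero).differentiableAt (S.hWopen.mem_nhds (S.hXW hx))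

theorem differentiableAt_wordMap (w : List E) {x : ℝ} (hx : x ∈ S.X) :
    DifferentiableAt ℝ (S.wordMap w) x := by
  induction w with
  | nil => exact differentiableAt_id
  | cons e w ih => exact (S.differentiableAt_φ e (S.mapsTo_wordMap w hx)).comp x ih

theorem continuousOn_wordMap (w : List E) : ContinuousOn (S.wordMap w) S.X :=
  fun _ hx => (S.differentiableAt_wordMap w hx).continuousAt.continuousWithinAt

theorem deriv_wordMap_cons (e : E) (w : List E) {x : ℝ} (hx : x ∈ S.X) :
    deriv (S.wordMap (e :: w)) x = deriv (S.φ e) (S.wordMap w x) * deriv (S.wordMap w) x :=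
  deriv_comp x (S.differentiableAt_φ e (S.mapsTo_wordMap w hx)) (S.differentiableAt_wordMap w hx)

theorem deriv_wordMap_append (u v : List E) {x : ℝ} (hx : x ∈ S.X) :
    deriv (S.wordMap (u ++ v)) x =
      deriv (S.wordMap u) (S.wordMap v x) * deriv (S.wordMap v) x := by
  rw [wordMap_append]
  exact deriv_comp x (S.differentiableAt_wordMap u (S.mapsTo_wordMap v hx))
    (S.differentiableAt_wordMap v hx)

theorem deriv_wordMap_ne_zero (w : List E) {x : ℝ} (hx : x ∈ S.X) :
    deriv (S.wordMap w) x ≠ 0 := by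
  induction w with
  | nil => simp [wordMap_nil]
  | cons e w ih =>
    rw [S.deriv_wordMap_cons e w hx]
    exact mul_ne_zero (S.deriv_ne e _ (S.hXW (S.mapsTo_wordMap w hx))) ih

theorem abs_wordMap_sub_le_pow (w : List E) {x y : ℝ} (hx : x ∈ S.X) (hy : y ∈ S.X) :
    |S.wordMap w x - S.wordMap w y| ≤ S.s ^ w.length * |x - y| := by
  induction w with
  | nil => simp [wordMap_nil]
  | cons e w ih =>
    calc |S.wordMap (e :: w) x - S.wordMap (e :: w) y|
        ≤ S.s * |S.wordMap w x - S.wordMap w y| :=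
          S.contract e _ (S.mapsTo_wordMap w hx) _ (S.mapsTo_wordMap w hy)
      _ ≤ S.s * (S.s ^ w.length * |x - y|) := mul_le_mul_of_nonneg_left ih S.hs0
      _ = S.s ^ (e :: w).length * |x - y| := by rw [List.length_cons]; ring

theorem exists_wordMap_sub_eq (w : List E) {x y : ℝ} (hx : x ∈ S.X) (hy : y ∈ S.X) :
    ∃ z ∈ S.X, |S.wordMap w x - S.wordMap w y| = |deriv (S.wordMap w) z| * |x - y| := by
  have key : ∀ x ∈ S.X, ∀ y ∈ S.X, x < y →
      ∃ z ∈ S.X, |S.wordMap w x - S.wordMap w y| = |deriv (S.wordMap w) z| * |x - y| := by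
    intro x hx y hy hxy
    have hsub : Icc x y ⊆ S.X := by
      rw [S.X_eq] at hx hy ⊢
      exact Icc_subset_Icc hx.1 hy.2
    obtain ⟨z, hz, e⟩ := exists_deriv_eq_slope (S.wordMap w) hxy
      ((S.continuousOn_wordMap w).mono hsub) fun z hz =>
        (S.differentiableAt_wordMap w (hsub (Ioo_subset_Icc_self hz))).differentiableWithinAt
    refine ⟨z, hsub (Ioo_subset_Icc_self hz), ?_⟩
    rw [e, ← abs_mul, abs_sub_comm, ← abs_neg ((_ / _) * _)]
    congr 1
    field_simp [(sub_pos.2 hxy).ne']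
    ring
  rcases lt_trichotomy x y with h | rfl | h
  · exact key x hx y hy h
  · exact ⟨x, hx, by simp⟩
  · rw [abs_sub_comm, abs_sub_comm x y]
    exact key y hy x hx h

theorem abs_deriv_wordMap_le_pow (w : List E) {x : ℝ} (hx : x ∈ S.X) :
    |deriv (S.wordMap w) x| ≤ S.s ^ w.length := by
  have hφ : ∀ e, ∀ x ∈ S.X, |deriv (S.φ e) x| ≤ S.s := by
    intro e x hx
    have hacc : (𝓝[S.X \ {x}] x).NeBot := by
      have := uniqueDiffOn_Icc S.lo_lt_hi x (S.X_eq ▸ hx)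
      rwa [uniqueDiffWithinAt_iff_accPt, accPt_principal_iff_nhdsWithin, ← S.X_eq] at this
    have hslope := hasDerivWithinAt_iff_tendsto_slope.1
      ((S.differentiableAt_φ e hx).hasDerivAt.hasDerivWithinAt (s := S.X))
    refine le_of_tendsto hslope.abs (eventually_mem_nhdsWithin.mono fun y hy => ?_)
    rw [slope_def_field, abs_div, div_le_iff₀ (abs_pos.2 (sub_ne_zero.2 hy.2))]
    exact S.contract e y hy.1 x hx
  induction w with
  | nil => simp [wordMap_nil]
  | cons e w ih =>
    rw [S.deriv_wordMap_cons e w hx, abs_mul, List.length_cons, pow_succ']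
    exact mul_le_mul (hφ e _ (S.mapsTo_wordMap w hx)) ih (abs_nonneg _) S.hs0

/-- The distortion constant of the system. -/
noncomputable def K : ℝ :=
  Real.exp (S.L * (S.hi - S.lo) ^ S.β * (1 - S.s ^ S.β)⁻¹)

theorem rpow_s_lt_one : S.s ^ S.β < 1 := Real.rpow_lt_one S.hs0 S.hs1 S.hβ

theorem one_le_K : 1 ≤ S.K := by
  have h1 := S.rpow_s_lt_one
  have h2 := S.hL
  have h3 := S.lo_lt_hi
  refine Real.one_le_exp (mul_nonneg (mul_nonneg (by linarith) ?_) (inv_nonneg.2 (by linarith)))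
  exact Real.rpow_nonneg (by linarith) _

theorem K_pos : 0 < S.K := Real.exp_pos _

theorem abs_deriv_φ_le (e : E) {x y : ℝ} (hx : x ∈ S.X) (hy : y ∈ S.X) :
    |deriv (S.φ e) x| ≤ Real.exp (S.L * |x - y| ^ S.β) * |deriv (S.φ e) y| := by
  have hinf : (⨅ z : S.W, |deriv (S.φ e) z|) ≤ |deriv (S.φ e) y| :=
    ciInf_le (f := fun z : S.W => |deriv (S.φ e) z|)
      ⟨0, by rintro _ ⟨z, rfl⟩; exact abs_nonneg _⟩ ⟨y, S.hXW hy⟩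
  have hL := S.hL
  have h1 := (le_abs_self _).trans (S.holder e y (S.hXW hy) x (S.hXW hx))
  have h2 : S.L * (⨅ z : S.W, |deriv (S.φ e) z|) * |x - y| ^ S.β ≤
      S.L * |deriv (S.φ e) y| * |x - y| ^ S.β := by gcongr
  have h3 := mul_le_mul_of_nonneg_right (Real.add_one_le_exp (S.L * |x - y| ^ S.β))
    (abs_nonneg (deriv (S.φ e) y))
  linarith

theorem abs_deriv_wordMap_le (w : List E) {x y : ℝ} (hx : x ∈ S.X) (hy : y ∈ S.X) :
    |deriv (S.wordMap w) x| ≤ S.K * |deriv (S.wordMap w) y| := by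
  set A := S.L * (S.hi - S.lo) ^ S.β with hA
  set q := S.s ^ S.β with hq
  have hD : 0 ≤ S.hi - S.lo := by linarith [S.lo_lt_hi]
  have hq0 : 0 ≤ q := Real.rpow_nonneg S.hs0 _
  have hL : 0 ≤ S.L := by linarith [S.hL]
  have hA0 : 0 ≤ A := mul_nonneg hL (Real.rpow_nonneg hD _)
  have key : |deriv (S.wordMap w) x| ≤
      Real.exp (A * ∑ k ∈ Finset.range w.length, q ^ k) * |deriv (S.wordMap w) y| := by
    induction w with
    | nil => simp [wordMap_nil]
    | cons e w ih =>
      have hd : S.L * |S.wordMap w x - S.wordMap w y| ^ S.β ≤ A * q ^ w.length := by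
        have h1 : |S.wordMap w x - S.wordMap w y| ≤ S.s ^ w.length * (S.hi - S.lo) :=
          (S.abs_wordMap_sub_le_pow w hx hy).trans
            (mul_le_mul_of_nonneg_left (S.abs_sub_le hx hy) (pow_nonneg S.hs0 _))
        have h2 := Real.rpow_le_rpow (abs_nonneg _) h1 S.hβ.le
        rw [Real.mul_rpow (pow_nonneg S.hs0 _) hD, ← Real.rpow_natCast, ← Real.rpow_mul S.hs0,
          mul_comm (w.length : ℝ), Real.rpow_mul S.hs0, Real.rpow_natCast] at h2
        calc _ ≤ S.L * (q ^ w.length * (S.hi - S.lo) ^ S.β) := mul_le_mul_of_nonneg_left h2 hL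
          _ = A * q ^ w.length := by rw [hA]; ring
      rw [S.deriv_wordMap_cons e w hx, S.deriv_wordMap_cons e w hy, abs_mul, abs_mul,
        List.length_cons, Finset.sum_range_succ, mul_add, Real.exp_add]
      calc _ ≤ (Real.exp (A * q ^ w.length) * |deriv (S.φ e) (S.wordMap w y)|) *
            (Real.exp (A * ∑ k ∈ Finset.range w.length, q ^ k) * |deriv (S.wordMap w) y|) := by
            refine mul_le_mul ?_ ih (abs_nonneg _) (by positivity)
            refine (S.abs_deriv_φ_le e (S.mapsTo_wordMap w hx) (S.mapsTo_wordMap w hy)).trans ?_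
            gcongr
        _ = _ := by ring
  refine key.trans (mul_le_mul_of_nonneg_right (Real.exp_le_exp.2 ?_) (abs_nonneg _))
  refine mul_le_mul_of_nonneg_left ?_ hA0
  rw [← tsum_geometric_of_lt_one hq0 S.rpow_s_lt_one]
  exact (summable_geometric_of_lt_one hq0 S.rpow_s_lt_one).sum_le_tsum _
    fun _ _ => pow_nonneg hq0 _

theorem bddAbove_abs_deriv (w : List E) :
    BddAbove (range fun x : S.X => |deriv (S.wordMap w) x|) :=
  ⟨S.s ^ w.length, by rintro _ ⟨x, rfl⟩; exact S.abs_deriv_wordMap_le_pow w x.2⟩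

theorem abs_deriv_le_wnorm (w : List E) {x : ℝ} (hx : x ∈ S.X) :
    |deriv (S.wordMap w) x| ≤ S.wnorm w :=
  le_ciSup (S.bddAbove_abs_deriv w) ⟨x, hx⟩

theorem wnorm_le {w : List E} {c : ℝ} (h : ∀ x ∈ S.X, |deriv (S.wordMap w) x| ≤ c) :
    S.wnorm w ≤ c :=
  have : Nonempty S.X := ⟨⟨S.lo, S.lo_mem⟩⟩
  ciSup_le fun x => h x x.2

theorem wnorm_le_pow (w : List E) : S.wnorm w ≤ S.s ^ w.length :=
  S.wnorm_le fun _ hx => S.abs_deriv_wordMap_le_pow w hx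

theorem wnorm_le_one (w : List E) : S.wnorm w ≤ 1 :=
  (S.wnorm_le_pow w).trans (pow_le_one₀ S.hs0 S.hs1.le)

theorem wnorm_pos (w : List E) : 0 < S.wnorm w :=
  (abs_pos.2 (S.deriv_wordMap_ne_zero w S.lo_mem)).trans_le (S.abs_deriv_le_wnorm w S.lo_mem)

theorem wnorm_nonneg (w : List E) : 0 ≤ S.wnorm w := (S.wnorm_pos w).le

theorem wnorm_le_K_mul (w : List E) {x : ℝ} (hx : x ∈ S.X) :
    S.wnorm w ≤ S.K * |deriv (S.wordMap w) x| :=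
  S.wnorm_le fun _ hy => S.abs_deriv_wordMap_le w hy hx

theorem wnorm_append_le (u v : List E) : S.wnorm (u ++ v) ≤ S.wnorm u * S.wnorm v :=
  S.wnorm_le fun x hx => by
    rw [S.deriv_wordMap_append u v hx, abs_mul]
    exact mul_le_mul (S.abs_deriv_le_wnorm u (S.mapsTo_wordMap v hx)) (S.abs_deriv_le_wnorm v hx)
      (abs_nonneg _) (S.wnorm_nonneg u)

theorem wnorm_mul_le (u v : List E) : S.wnorm u * S.wnorm v ≤ S.K * S.wnorm (u ++ v) := by
  rw [mul_comm, ← le_div_iff₀ (S.wnorm_pos u)]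
  refine S.wnorm_le fun x hx => ?_
  rw [le_div_iff₀ (S.wnorm_pos u), mul_comm]
  calc S.wnorm u * |deriv (S.wordMap v) x|
      ≤ S.K * |deriv (S.wordMap u) (S.wordMap v x)| * |deriv (S.wordMap v) x| :=
        mul_le_mul_of_nonneg_right (S.wnorm_le_K_mul u (S.mapsTo_wordMap v hx)) (abs_nonneg _)
    _ = S.K * |deriv (S.wordMap (u ++ v)) x| := by
        rw [S.deriv_wordMap_append u v hx, abs_mul, mul_assoc]
    _ ≤ S.K * S.wnorm (u ++ v) :=
        mul_le_mul_of_nonneg_left (S.abs_deriv_le_wnorm _ hx) S.K_pos.le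

theorem abs_wordMap_sub_le (w : List E) {x y : ℝ} (hx : x ∈ S.X) (hy : y ∈ S.X) :
    |S.wordMap w x - S.wordMap w y| ≤ S.wnorm w * |x - y| := by
  obtain ⟨z, hz, e⟩ := S.exists_wordMap_sub_eq w hx hy
  rw [e]
  exact mul_le_mul_of_nonneg_right (S.abs_deriv_le_wnorm w hz) (abs_nonneg _)

theorem le_abs_wordMap_sub (w : List E) {x y : ℝ} (hx : x ∈ S.X) (hy : y ∈ S.X) :
    S.K⁻¹ * S.wnorm w * |x - y| ≤ |S.wordMap w x - S.wordMap w y| := by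
  obtain ⟨z, hz, e⟩ := S.exists_wordMap_sub_eq w hx hy
  rw [e]
  refine mul_le_mul_of_nonneg_right ?_ (abs_nonneg _)
  rw [inv_mul_le_iff₀ S.K_pos]
  exact S.wnorm_le_K_mul w hz

theorem mapsTo_φ_interior (e : E) : MapsTo (S.φ e) (interior S.X) (interior S.X) := by
  intro x hx
  have hne := S.deriv_ne e x (S.hXW (interior_subset hx))
  have hmem := S.maps e (interior_subset hx)
  have hnhds : ∀ᶠ y in 𝓝 x, S.φ e y ∈ S.X :=
    mem_of_superset (mem_interior_iff_mem_nhds.1 hx) fun y hy => S.maps e hy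
  rw [S.X_eq] at hmem hnhds
  rw [S.interior_X]
  refine ⟨lt_of_le_of_ne hmem.1 fun h => hne ?_, lt_of_le_of_ne hmem.2 fun h => hne ?_⟩
  · refine IsLocalMin.deriv_eq_zero (hnhds.mono fun y hy => ?_)
    rw [← h]
    exact hy.1
  · refine IsLocalMax.deriv_eq_zero (hnhds.mono fun y hy => ?_)
    rw [h]
    exact hy.2

theorem mapsTo_wordMap_interior (w : List E) :
    MapsTo (S.wordMap w) (interior S.X) (interior S.X) := by
  induction w with
  | nil => exact fun x hx => hx
  | cons e w ih => exact (S.mapsTo_φ_interior e).comp ih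

theorem disjoint_wordMap_image (u v : List E) (hl : u.length = v.length) (hne : u ≠ v) :
    Disjoint (S.wordMap u '' interior S.X) (S.wordMap v '' interior S.X) := by
  induction u generalizing v with
  | nil => exact absurd (List.length_eq_zero_iff.1 hl.symm).symm hne
  | cons e u ih =>
    match v with
    | [] => simp at hl
    | f :: v =>
      rw [Set.disjoint_left]
      rintro _ ⟨x, hx, rfl⟩ ⟨y, hy, hxy⟩
      have hu := S.mapsTo_wordMap_interior u hx
      have hv := S.mapsTo_wordMap_interior v hy
      by_cases hef : e = f
      · subst hef
        have huv : S.wordMap v y = S.wordMap u x :=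
          S.inj e (interior_subset hv) (interior_subset hu) hxy
        exact Set.disjoint_left.1 (ih v (by simpa using hl) fun h => hne (by rw [h]))
          ⟨x, hx, rfl⟩ ⟨y, hy, huv⟩
      · exact Set.disjoint_left.1 (S.osc e f hef) ⟨_, hu, rfl⟩ ⟨_, hv, hxy⟩

/-- The words of length `n` over `F`. -/
abbrev Words (F : Set E) (n : ℕ) : Type _ := {w : List E // w.length = n ∧ ∀ e ∈ w, e ∈ F}

/-- The summand `‖φ'_w‖ ^ t` of the partition function. -/
noncomputable def weight (t : ℝ) (w : List E) : ℝ≥0∞ := ENNReal.ofReal (S.wnorm w ^ t)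

theorem Z_eq (F : Set E) (t : ℝ) (n : ℕ) : S.Z F t n = ∑' w : Words F n, S.weight t w := rfl

theorem weight_ne_zero (t : ℝ) (w : List E) : S.weight t w ≠ 0 := by
  simpa [weight] using Real.rpow_pos_of_pos (S.wnorm_pos w) t

theorem weight_ne_top (t : ℝ) (w : List E) : S.weight t w ≠ ∞ := ENNReal.ofReal_ne_top

theorem weight_le_one {t : ℝ} (ht : 0 ≤ t) (w : List E) : S.weight t w ≤ 1 :=
  ENNReal.ofReal_le_one.2 (Real.rpow_le_one (S.wnorm_nonneg w) (S.wnorm_le_one w) ht)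

theorem weight_append_le {t : ℝ} (ht : 0 ≤ t) (u v : List E) :
    S.weight t (u ++ v) ≤ S.weight t u * S.weight t v := by
  rw [weight, weight, weight, ← ENNReal.ofReal_mul (Real.rpow_nonneg (S.wnorm_nonneg u) t),
    ← Real.mul_rpow (S.wnorm_nonneg u) (S.wnorm_nonneg v)]
  exact ENNReal.ofReal_le_ofReal
    (Real.rpow_le_rpow (S.wnorm_nonneg _) (S.wnorm_append_le u v) ht)

theorem weight_mul_le {t : ℝ} (ht : 0 ≤ t) (u v : List E) :
    S.weight t u * S.weight t v ≤ ENNReal.ofReal (S.K ^ t) * S.weight t (u ++ v) := by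
  rw [weight, weight, weight, ← ENNReal.ofReal_mul (Real.rpow_nonneg (S.wnorm_nonneg u) t),
    ← ENNReal.ofReal_mul (Real.rpow_nonneg S.K_pos.le t),
    ← Real.mul_rpow (S.wnorm_nonneg u) (S.wnorm_nonneg v),
    ← Real.mul_rpow S.K_pos.le (S.wnorm_nonneg _)]
  exact ENNReal.ofReal_le_ofReal (Real.rpow_le_rpow
    (mul_nonneg (S.wnorm_nonneg _) (S.wnorm_nonneg _)) (S.wnorm_mul_le u v) ht)

theorem weight_le_pow_mul {t t' : ℝ} (h : t ≤ t') (w : List E) :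
    S.weight t' w ≤ ENNReal.ofReal (S.s ^ (t' - t)) ^ w.length * S.weight t w := by
  rw [weight, weight, ← ENNReal.ofReal_pow (Real.rpow_nonneg S.hs0 _),
    ← ENNReal.ofReal_mul (pow_nonneg (Real.rpow_nonneg S.hs0 _) _)]
  refine ENNReal.ofReal_le_ofReal ?_
  have e : S.wnorm w ^ t' = S.wnorm w ^ (t' - t) * S.wnorm w ^ t := by
    rw [← Real.rpow_add (S.wnorm_pos w), sub_add_cancel]
  rw [e]
  refine mul_le_mul_of_nonneg_right ?_ (Real.rpow_nonneg (S.wnorm_nonneg w) t)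
  rw [← Real.rpow_natCast, ← Real.rpow_mul S.hs0, mul_comm, Real.rpow_mul S.hs0,
    Real.rpow_natCast]
  exact Real.rpow_le_rpow (S.wnorm_nonneg w) (S.wnorm_le_pow w) (sub_nonneg.2 h)

theorem Z_mono {F G : Set E} (h : F ⊆ G) (t : ℝ) (n : ℕ) : S.Z F t n ≤ S.Z G t n :=
  ENNReal.tsum_mono_subtype (fun w => S.weight t w)
    (s := {w | w.length = n ∧ ∀ e ∈ w, e ∈ F}) (t := {w | w.length = n ∧ ∀ e ∈ w, e ∈ G})
    fun _ hw => ⟨hw.1, fun e he => h (hw.2 e he)⟩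

theorem lam_mono {F G : Set E} (h : F ⊆ G) (t : ℝ) : S.lam F t ≤ S.lam G t :=
  limsup_le_limsup (Eventually.of_forall fun n =>
    ENNReal.rpow_le_rpow (S.Z_mono h t n) (inv_nonneg.2 n.cast_nonneg))

theorem Z_le_pow_mul (F : Set E) {t t' : ℝ} (h : t ≤ t') (n : ℕ) :
    S.Z F t' n ≤ ENNReal.ofReal (S.s ^ (t' - t)) ^ n * S.Z F t n := by
  rw [Z_eq, Z_eq, ← ENNReal.tsum_mul_left]
  exact ENNReal.tsum_le_tsum fun w => by simpa [w.2.1] using S.weight_le_pow_mul h w.1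

theorem lam_le_mul (F : Set E) {t t' : ℝ} (h : t ≤ t') :
    S.lam F t' ≤ ENNReal.ofReal (S.s ^ (t' - t)) * S.lam F t := by
  rw [lam, lam, ← ENNReal.limsup_const_mul_of_ne_top ENNReal.ofReal_ne_top]
  refine limsup_le_limsup ((eventually_ge_atTop 1).mono fun n hn => ?_)
  have hn0 : (n : ℝ) ≠ 0 := by positivity
  have hinv : (0 : ℝ) ≤ (n : ℝ)⁻¹ := inv_nonneg.2 n.cast_nonneg
  refine (ENNReal.rpow_le_rpow (S.Z_le_pow_mul F h n) hinv).trans_eq ?_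
  rw [ENNReal.mul_rpow_of_nonneg _ _ hinv, ← ENNReal.rpow_natCast, ← ENNReal.rpow_mul,
    mul_inv_cancel₀ hn0, ENNReal.rpow_one]

theorem ofReal_rpow_s_lt_one {r : ℝ} (hr : 0 < r) : ENNReal.ofReal (S.s ^ r) < 1 :=
  ENNReal.ofReal_lt_one.2 (Real.rpow_lt_one S.hs0 S.hs1 hr)

theorem lam_lt_one_of_lt {F : Set E} {t t' : ℝ} (h : t < t') (hlam : S.lam F t ≤ 1) :
    S.lam F t' < 1 := by
  refine (S.lam_le_mul F h.le).trans_lt ?_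
  calc _ ≤ ENNReal.ofReal (S.s ^ (t' - t)) * 1 := by gcongr
    _ < 1 := by rw [mul_one]; exact S.ofReal_rpow_s_lt_one (sub_pos.2 h)

/-- Below the critical value, the partition functions decay exponentially. -/
theorem exists_eventually_Z_le_pow {F : Set E} {t : ℝ} (h : S.lam F t < 1) :
    ∃ r : ℝ≥0∞, r < 1 ∧ ∀ᶠ n in atTop, S.Z F t n ≤ r ^ n := by
  obtain ⟨r, hr, hr1⟩ := exists_between h
  refine ⟨r, hr1, ?_⟩
  filter_upwards [eventually_lt_of_limsup_lt hr, eventually_ge_atTop 1] with n hn hn1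
  have hn0 : (n : ℝ) ≠ 0 := by positivity
  have := ENNReal.rpow_le_rpow hn.le n.cast_nonneg
  rwa [← ENNReal.rpow_mul, inv_mul_cancel₀ hn0, ENNReal.rpow_one, ENNReal.rpow_natCast] at this

theorem Z_mul_le (F : Set E) {t : ℝ} (ht : 0 ≤ t) (m n : ℕ) :
    S.Z F t m * S.Z F t n ≤ ENNReal.ofReal (S.K ^ t) * S.Z F t (m + n) := by
  let j : Words F m × Words F n → Words F (m + n) := fun p =>
    ⟨p.1.1 ++ p.2.1, by simp [p.1.2.1, p.2.2.1], fun e he =>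
      (List.mem_append.1 he).elim (p.1.2.2 e) (p.2.2.2 e)⟩
  have hj : Function.Injective j := by
    rintro ⟨u, v⟩ ⟨u', v'⟩ h
    have h' : u.1 ++ v.1 = u'.1 ++ v'.1 := congrArg Subtype.val h
    obtain ⟨h1, h2⟩ := List.append_inj h' (u.2.1.trans u'.2.1.symm)
    exact Prod.ext (Subtype.ext h1) (Subtype.ext h2)
  calc S.Z F t m * S.Z F t n
      = ∑' p : Words F m × Words F n, S.weight t p.1 * S.weight t p.2 := by
        rw [ENNReal.tsum_prod (f := fun (u : Words F m) (v : Words F n) =>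
          S.weight t u * S.weight t v), Z_eq, Z_eq, ← ENNReal.tsum_mul_right]
        simp_rw [ENNReal.tsum_mul_left]
    _ ≤ ∑' p, ENNReal.ofReal (S.K ^ t) * S.weight t (j p) :=
        ENNReal.tsum_le_tsum fun p => S.weight_mul_le ht _ _
    _ ≤ ENNReal.ofReal (S.K ^ t) * S.Z F t (m + n) := by
        rw [ENNReal.tsum_mul_left]
        gcongr
        exact ENNReal.tsum_comp_le_tsum_of_injective hj fun w => S.weight t w

theorem Z_zero (F : Set E) (t : ℝ) : S.Z F t 0 ≤ 1 := by
  have : Subsingleton (Words F 0) := ⟨fun u v => Subtype.ext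
    ((List.length_eq_zero_iff.1 u.2.1).trans (List.length_eq_zero_iff.1 v.2.1).symm)⟩
  rw [Z_eq, tsum_eq_single (⟨[], rfl, by simp⟩ : Words F 0)
    fun w hw => absurd (Subsingleton.elim _ _) hw]
  have h1 : S.wnorm [] = 1 := by
    have : Nonempty S.X := ⟨⟨S.lo, S.lo_mem⟩⟩
    simp [wnorm, wordMap_nil]
  simp [weight, h1]

theorem Z_ne_top {F : Set E} {t : ℝ} (ht : 0 ≤ t) (h : S.lam F t < 1) (n : ℕ) :
    S.Z F t n ≠ ∞ := by
  intro htop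
  obtain ⟨r, hr, hev⟩ := S.exists_eventually_Z_le_pow h
  obtain ⟨w⟩ : Nonempty (Words F n) := by
    by_contra hne
    rw [not_nonempty_iff] at hne
    rw [Z_eq, tsum_empty] at htop
    exact ENNReal.zero_ne_top htop
  rcases Nat.eq_zero_or_pos n with rfl | hn
  · exact (S.Z_zero F t).not_gt (htop ▸ ENNReal.one_lt_top)
  obtain ⟨e, he⟩ := List.exists_mem_of_length_pos (w.2.1.symm ▸ hn)
  obtain ⟨N, hN⟩ := eventually_atTop.1 hev
  have h1 := S.Z_mul_le F ht n N
  have h2 : S.Z F t N ≠ 0 := fun h0 =>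
    S.weight_ne_zero t _ (ENNReal.tsum_eq_zero.1 h0 (⟨List.replicate N e, by simp, fun f hf =>
      (List.eq_of_mem_replicate hf).symm ▸ w.2.2 e he⟩ : Words F N))
  rw [htop, ENNReal.top_mul h2, top_le_iff] at h1
  have h3 : S.Z F t (n + N) ≤ 1 :=
    (hN (n + N) (Nat.le_add_left _ _)).trans (pow_le_one₀ zero_le hr.le)
  exact ENNReal.mul_ne_top ENNReal.ofReal_ne_top (ne_top_of_le_ne_top ENNReal.one_ne_top h3) h1

theorem tsum_Z_ne_top {F : Set E} {t : ℝ} (ht : 0 ≤ t) (h : S.lam F t < 1) :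
    ∑' n, S.Z F t n ≠ ∞ := by
  obtain ⟨r, hr, hev⟩ := S.exists_eventually_Z_le_pow h
  obtain ⟨N, hN⟩ := eventually_atTop.1 hev
  rw [← ENNReal.summable.sum_add_tsum_nat_add' (k := N)]
  refine ENNReal.add_ne_top.2 ⟨ENNReal.sum_ne_top.2 fun n _ => S.Z_ne_top ht h n, ?_⟩
  have h1 : ∑' n, S.Z F t (n + N) ≤ ∑' n, r ^ n := by
    refine ENNReal.tsum_le_tsum fun n => (hN _ (Nat.le_add_left _ _)).trans ?_
    exact pow_le_pow_of_le_one zero_le hr.le (Nat.le_add_right _ _)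
  refine ne_top_of_le_ne_top ?_ h1
  rw [ENNReal.tsum_geometric, ENNReal.inv_ne_top]
  exact (tsub_pos_of_lt hr).ne'

theorem exists_lt_Z {F : Set E} {t : ℝ} (h : 1 < S.lam F t) {C : ℝ≥0∞} (hC : C ≠ ∞) :
    ∃ n, 1 ≤ n ∧ C < S.Z F t n := by
  obtain ⟨r, hr1, hr⟩ := exists_between h
  have hfr : ∃ᶠ n : ℕ in atTop, r < S.Z F t n ^ ((n : ℝ)⁻¹) :=
    frequently_lt_of_lt_limsup (by isBoundedDefault) hr
  have hev : ∀ᶠ n : ℕ in atTop, C < r ^ n :=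
    (ENNReal.tendsto_pow_atTop_nhds_top_iff.2 hr1).eventually_const_lt hC.lt_top
  obtain ⟨n, hn, hn1, hn2⟩ := (hfr.and_eventually ((eventually_ge_atTop 1).and hev)).exists
  have hn0 : (n : ℝ) ≠ 0 := by positivity
  refine ⟨n, hn1, hn2.trans_le ?_⟩
  have := ENNReal.rpow_le_rpow hn.le n.cast_nonneg
  rwa [← ENNReal.rpow_mul, inv_mul_cancel₀ hn0, ENNReal.rpow_one, ENNReal.rpow_natCast] at this

theorem lam_le_one_of_bounded {F : Set E} {t : ℝ} {C : ℝ≥0∞} (hC : C ≠ ∞)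
    (h : ∀ n, S.Z F t n ≤ C) : S.lam F t ≤ 1 := by
  by_contra! hlt
  obtain ⟨n, _, hn⟩ := S.exists_lt_Z hlt hC
  exact hn.not_ge (h n)

theorem one_le_ofReal_K_rpow {t : ℝ} (ht : 0 ≤ t) : 1 ≤ ENNReal.ofReal (S.K ^ t) :=
  ENNReal.one_le_ofReal.2 (Real.one_le_rpow S.one_le_K ht)

theorem one_lt_lam_of_lt_Z {F : Set E} {t : ℝ} (ht : 0 ≤ t) {n : ℕ} (hn : 1 ≤ n)
    (h : ENNReal.ofReal (S.K ^ t) < S.Z F t n) : 1 < S.lam F t := by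
  set c := ENNReal.ofReal (S.K ^ t) with hc
  have hc1 : 1 ≤ c := S.one_le_ofReal_K_rpow ht
  have hc0 : c ≠ 0 := (zero_lt_one.trans_le hc1).ne'
  have hct : c ≠ ∞ := ENNReal.ofReal_ne_top
  obtain ⟨r, hr1, hr⟩ : ∃ r, 1 < r ∧ r < S.Z F t n / c :=
    exists_between (by rwa [ENNReal.lt_div_iff_mul_lt (.inl hc0) (.inl hct), one_mul])
  have hZ : ∀ k : ℕ, c * r ^ (k + 1) ≤ S.Z F t (n * (k + 1)) := by
    have hstep : r * c ≤ S.Z F t n :=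
      (ENNReal.le_div_iff_mul_le (.inl hc0) (.inl hct)).1 hr.le
    intro k
    induction k with
    | zero => simpa [mul_comm] using hstep
    | succ k ih =>
      refine (ENNReal.mul_le_mul_iff_right hc0 hct).1 ?_
      calc c * (c * r ^ (k + 1 + 1)) = (c * r ^ (k + 1)) * (r * c) := by ring
        _ ≤ S.Z F t (n * (k + 1)) * S.Z F t n := by gcongr
        _ ≤ c * S.Z F t (n * (k + 1) + n) := S.Z_mul_le F ht _ _
        _ = c * S.Z F t (n * (k + 1 + 1)) := by rw [mul_add n (k + 1) 1, mul_one]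
  have hn0 : (0 : ℝ) < n := by exact_mod_cast hn
  have hrn : 1 < r ^ ((n : ℝ)⁻¹) := ENNReal.one_lt_rpow hr1 (inv_pos.2 hn0)
  refine hrn.trans_le (le_limsup_of_frequently_le (frequently_atTop.2 fun N => ?_)
    (by isBoundedDefault))
  refine ⟨n * (N + 1), ?_, ?_⟩
  · change N ≤ n * (N + 1)
    nlinarith
  · have h1 : r ^ (N + 1) ≤ S.Z F t (n * (N + 1)) :=
      (le_mul_of_one_le_left zero_le hc1).trans (hZ N)
    have h2 := ENNReal.rpow_le_rpow h1 (inv_nonneg.2 (Nat.cast_nonneg (n * (N + 1))))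
    refine le_trans (le_of_eq ?_) h2
    rw [← ENNReal.rpow_natCast, ← ENNReal.rpow_mul]
    congr 1
    push_cast
    field_simp

/-- `λ_F(t) > 1` is already witnessed by a finite part of the alphabet. -/
theorem exists_finite_one_lt_lam {F : Set E} {t : ℝ} (ht : 0 ≤ t) (h : 1 < S.lam F t) :
    ∃ G ⊆ F, G.Finite ∧ 1 < S.lam G t := by
  obtain ⟨n, hn, hZ⟩ := S.exists_lt_Z h (C := ENNReal.ofReal (S.K ^ t)) ENNReal.ofReal_ne_top
  rw [Z_eq, ENNReal.tsum_eq_iSup_sum, lt_iSup_iff] at hZ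
  obtain ⟨A, hA⟩ := hZ
  refine ⟨⋃ w ∈ A, {e | e ∈ w.1}, ?_, ?_, S.one_lt_lam_of_lt_Z ht hn (hA.trans_le ?_)⟩
  · exact iUnion₂_subset fun w _ e he => w.2.2 e he
  · exact A.finite_toSet.biUnion fun w _ => List.finite_toSet w.1
  · rw [Z_eq, ← Finset.sum_coe_sort, ← tsum_fintype (L := .unconditional _)]
    let j : A → Words (⋃ w ∈ A, {e | e ∈ w.1}) n := fun w =>
      ⟨w.1.1, w.1.2.1, fun e he => mem_iUnion₂.2 ⟨w.1, w.2, he⟩⟩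
    have hj : Function.Injective j := fun u v huv =>
      Subtype.ext (Subtype.ext (congrArg (fun w => w.1) huv))
    exact ENNReal.tsum_comp_le_tsum_of_injective hj fun w => S.weight t w

/-- Adjoining a letter of small norm does not push `λ` from below `1` to above `1`. -/
theorem lam_union_singleton_le_one {F : Set E} {t : ℝ} (ht : 0 ≤ t) (h : S.lam F t < 1) {b : E}
    (hb : S.weight t [b] * ∑' n, S.Z F t n ≤ 1) : S.lam (F ∪ {b}) t ≤ 1 := by
  have hlists : ∑' u : {u : List E // ∀ e ∈ u, e ∈ F}, S.weight t u ≤ ∑' n, S.Z F t n := by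
    simp_rw [Z_eq]
    rw [← ENNReal.tsum_sigma (f := fun n (w : Words F n) => S.weight t w)]
    let j : {u : List E // ∀ e ∈ u, e ∈ F} → Σ n, Words F n := fun u =>
      ⟨u.1.length, u.1, rfl, u.2⟩
    have hj : Function.LeftInverse (fun w : Σ n, Words F n =>
      (⟨w.2.1, w.2.2.2⟩ : {u : List E // ∀ e ∈ u, e ∈ F})) j := fun u => rfl
    exact ENNReal.tsum_comp_le_tsum_of_injective hj.injective fun w => S.weight t w.2
  set U : List E → ℝ≥0∞ := fun v =>
    ∑' u : {u : List E // ∀ e ∈ u, e ∈ F}, S.weight t (u ++ v) with hU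
  have hUself : ∀ v, S.weight t v ≤ U v := fun v =>
    ENNReal.le_tsum (f := fun u : {u : List E // ∀ e ∈ u, e ∈ F} => S.weight t (u ++ v))
      ⟨[], by simp⟩
  have hUF : ∀ v, S.weight t v + ∑' e : F, U (e :: v) ≤ U v := by
    intro v
    let j : Unit ⊕ (F × {u : List E // ∀ e ∈ u, e ∈ F}) → {u : List E // ∀ e ∈ u, e ∈ F} :=
      Sum.elim (fun _ => ⟨[], by simp⟩) fun p => ⟨p.2.1 ++ [p.1.1], by
        intro e he
        rcases List.mem_append.1 he with he | he
        · exact p.2.2 e he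
        · exact (List.mem_singleton.1 he).symm ▸ p.1.2⟩
    have hj : Function.Injective j := by
      rintro (_ | ⟨e, u⟩) (_ | ⟨e', u'⟩) huv
      · rfl
      · simp [j] at huv
      · simp [j] at huv
      · have h1 : u.1 ++ [e.1] = u'.1 ++ [e'.1] := congrArg Subtype.val huv
        obtain ⟨h2, h3⟩ := List.append_inj' h1 rfl
        rw [Subtype.ext h2, Subtype.ext (List.singleton_inj.1 h3)]
    have h1 := ENNReal.tsum_comp_le_tsum_of_injective hj
      fun u : {u : List E // ∀ e ∈ u, e ∈ F} => S.weight t (u ++ v)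
    refine le_trans (le_of_eq ?_) h1
    rw [ENNReal.summable.tsum_sum ENNReal.summable, ENNReal.tsum_prod']
    simp [j, hU]
  have hUb : ∀ v, U (b :: v) ≤ S.weight t v := by
    intro v
    calc U (b :: v)
        ≤ ∑' u : {u : List E // ∀ e ∈ u, e ∈ F},
            S.weight t u * (S.weight t [b] * S.weight t v) := by
          refine ENNReal.tsum_le_tsum fun u => (S.weight_append_le ht _ _).trans ?_
          gcongr
          exact S.weight_append_le ht [b] v
      _ ≤ (∑' n, S.Z F t n) * (S.weight t [b] * S.weight t v) := by
          rw [ENNReal.tsum_mul_right]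
          gcongr
      _ = (S.weight t [b] * ∑' n, S.Z F t n) * S.weight t v := by ring
      _ ≤ S.weight t v := mul_le_of_le_one_left zero_le hb
  have hUG : ∀ v, ∑' e : ↑(F ∪ {b}), U (e :: v) ≤ U v := fun v =>
    calc ∑' e : ↑(F ∪ {b}), U (e :: v)
        ≤ ∑' e : F, U (e :: v) + ∑' e : ({b} : Set E), U (e :: v) :=
          ENNReal.tsum_union_le (fun e => U (e :: v)) _ _
      _ ≤ ∑' e : F, U (e :: v) + S.weight t v := by
          gcongr
          rw [tsum_singleton b fun e => U (e :: v)]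
          exact hUb v
      _ ≤ U v := by rw [add_comm]; exact hUF v
  have hsum : ∀ n, ∑' w : Words (F ∪ {b}) n, U w ≤ ∑' n, S.Z F t n := by
    intro n
    induction n with
    | zero =>
      have : Subsingleton (Words (F ∪ {b}) 0) := ⟨fun u v => Subtype.ext
        ((List.length_eq_zero_iff.1 u.2.1).trans (List.length_eq_zero_iff.1 v.2.1).symm)⟩
      rw [tsum_eq_single (⟨[], rfl, by simp⟩ : Words (F ∪ {b}) 0)
        fun w hw => absurd (Subsingleton.elim _ _) hw]
      simpa [hU] using hlists
    | succ n ih =>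
      let j : Words (F ∪ {b}) n × ↑(F ∪ {b}) → Words (F ∪ {b}) (n + 1) := fun p =>
        ⟨p.2.1 :: p.1.1, by simp [p.1.2.1], fun e he => by
          rcases List.mem_cons.1 he with he | he
          · exact he ▸ p.2.2
          · exact p.1.2.2 e he⟩
      have hj : Function.Surjective j := by
        rintro ⟨w, hw, hwF⟩
        match w with
        | [] => simp at hw
        | e :: w =>
          exact ⟨⟨⟨w, by simpa using hw, fun f hf => hwF f (List.mem_cons_of_mem _ hf)⟩,
            ⟨e, hwF e List.mem_cons_self⟩⟩, rfl⟩
      calc ∑' w : Words (F ∪ {b}) (n + 1), U w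
          ≤ ∑' p : Words (F ∪ {b}) n × ↑(F ∪ {b}), U (j p) :=
            ENNReal.tsum_le_tsum_comp_of_surjective hj fun w => U w
        _ = ∑' w : Words (F ∪ {b}) n, ∑' e : ↑(F ∪ {b}), U (e :: w) := ENNReal.tsum_prod'
        _ ≤ ∑' w : Words (F ∪ {b}) n, U w := ENNReal.tsum_le_tsum fun w => hUG w
        _ ≤ _ := ih
  exact S.lam_le_one_of_bounded (S.tsum_Z_ne_top ht h) fun n =>
    (ENNReal.tsum_le_tsum fun w : Words (F ∪ {b}) n => hUself w).trans (hsum n)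

theorem limitSet_subset_iUnion (F : Set E) {n : ℕ} (hn : 1 ≤ n) :
    S.limitSet F ⊆ ⋃ w : Words F n, S.wordMap w '' S.X := by
  rintro x ⟨ω, hω, hx⟩
  refine mem_iUnion.2 ⟨⟨(List.range n).map ω, by simp, ?_⟩, hx n hn⟩
  intro e he
  obtain ⟨k, _, rfl⟩ := List.mem_map.1 he
  exact hω k

theorem ediam_wordMap_image_le (w : List E) :
    Metric.ediam (S.wordMap w '' S.X) ≤ ENNReal.ofReal (S.wnorm w * (S.hi - S.lo)) := by
  refine Metric.ediam_le ?_
  rintro _ ⟨x, hx, rfl⟩ _ ⟨y, hy, rfl⟩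
  rw [edist_dist, Real.dist_eq]
  exact ENNReal.ofReal_le_ofReal ((S.abs_wordMap_sub_le w hx hy).trans
    (mul_le_mul_of_nonneg_left (S.abs_sub_le hx hy) (S.wnorm_nonneg w)))

theorem dimH_limitSet_le_of_lam_lt_one [Countable E] {F : Set E} {t : ℝ} (ht : 0 ≤ t)
    (h : S.lam F t < 1) : dimH (S.limitSet F) ≤ ENNReal.ofReal t := by
  have hD : 0 ≤ S.hi - S.lo := by linarith [S.lo_lt_hi]
  obtain ⟨r, hr, hev⟩ := S.exists_eventually_Z_le_pow h
  have hzero : Tendsto (fun n => ENNReal.ofReal ((S.hi - S.lo) ^ t) * S.Z F t n) atTop (𝓝 0) := by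
    have h1 : Tendsto (fun n => S.Z F t n) atTop (𝓝 0) :=
      tendsto_of_tendsto_of_tendsto_of_le_of_le' tendsto_const_nhds
        (ENNReal.tendsto_pow_atTop_nhds_zero_of_lt_one hr) (Eventually.of_forall fun _ => zero_le)
        hev
    simpa using ENNReal.Tendsto.const_mul h1 (.inr ENNReal.ofReal_ne_top)
  have hdiam : Tendsto (fun n : ℕ => ENNReal.ofReal (S.s ^ n * (S.hi - S.lo))) atTop (𝓝 0) := by
    rw [← ENNReal.ofReal_zero]
    refine ENNReal.tendsto_ofReal ?_
    simpa using (tendsto_pow_atTop_nhds_zero_of_lt_one S.hs0 S.hs1).mul_const (S.hi - S.lo)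
  have hμ : μH[t] (S.limitSet F) ≤ 0 := by
    refine (Measure.hausdorffMeasure_le_liminf_tsum t (S.limitSet F) _ hdiam
      (fun n (w : Words F n) => S.wordMap w '' S.X) (Eventually.of_forall fun n w => ?_)
      ((eventually_ge_atTop 1).mono fun n hn => S.limitSet_subset_iUnion F hn)).trans ?_
    · refine (S.ediam_wordMap_image_le w.1).trans (ENNReal.ofReal_le_ofReal ?_)
      refine mul_le_mul_of_nonneg_right ?_ hD
      simpa [w.2.1] using S.wnorm_le_pow w.1
    · rw [← hzero.liminf_eq]
      refine liminf_le_liminf (Eventually.of_forall fun n => ?_)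
      rw [Z_eq, ← ENNReal.tsum_mul_left]
      refine ENNReal.tsum_le_tsum fun w => ?_
      refine (ENNReal.rpow_le_rpow (S.ediam_wordMap_image_le w.1) ht).trans_eq ?_
      rw [ENNReal.ofReal_rpow_of_nonneg (mul_nonneg (S.wnorm_nonneg _) hD) ht,
        Real.mul_rpow (S.wnorm_nonneg _) hD, mul_comm, ENNReal.ofReal_mul (Real.rpow_nonneg hD t)]
      rfl
  refine dimH_le_of_hausdorffMeasure_ne_top (d := t.toNNReal) ?_
  rw [Real.coe_toNNReal t ht, le_zero_iff.1 hμ]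
  exact ENNReal.zero_ne_top

/-- The upper half of Bowen's formula. -/
theorem dimH_limitSet_le [Countable E] {F : Set E} {t : ℝ} (ht : 0 ≤ t) (h : S.lam F t ≤ 1) :
    dimH (S.limitSet F) ≤ ENNReal.ofReal t := by
  have hlim : Tendsto (fun u : ℝ => ENNReal.ofReal u) (𝓝[>] t) (𝓝 (ENNReal.ofReal t)) :=
    (ENNReal.continuous_ofReal.tendsto t).mono_left nhdsWithin_le_nhds
  refine ge_of_tendsto hlim (eventually_mem_nhdsWithin.mono fun u hu => ?_)
  exact S.dimH_limitSet_le_of_lam_lt_one (ht.trans (le_of_lt hu)) (S.lam_lt_one_of_lt hu h)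

theorem subset_limitSet {F : Set E} {T : Set ℝ} (hTX : T ⊆ S.X)
    (hT : ∀ x ∈ T, ∃ e ∈ F, ∃ y ∈ T, x = S.φ e y) : T ⊆ S.limitSet F := by
  intro x hx
  have : Nonempty E := let ⟨e, _⟩ := hT x hx; ⟨e⟩
  choose! e he y hy hxy using hT
  have hiter : ∀ n, y^[n] x ∈ T := fun n => by
    induction n with
    | zero => exact hx
    | succ n ih => rw [Function.iterate_succ_apply']; exact hy _ ih
  have hword : ∀ n, x = S.wordMap ((List.range n).map fun k => e (y^[k] x)) (y^[n] x) := fun n => by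
    induction n with
    | zero => rfl
    | succ n ih =>
      rw [List.range_succ, List.map_append, wordMap_append, Function.comp_apply,
        Function.iterate_succ_apply']
      change x = S.wordMap _ (S.φ (e (y^[n] x)) (y (y^[n] x)))
      rw [← hxy _ (hiter n), ← ih]
  exact ⟨fun k => e (y^[k] x), fun k => he _ (hiter k), fun n _ =>
    ⟨_, hTX (hiter n), (hword n).symm⟩⟩

theorem subset_limitSet_of_words {F : Set E} {T : Set ℝ} (hTX : T ⊆ S.X)
    (hT : ∀ x ∈ T, ∃ w : List E, w ≠ [] ∧ (∀ e ∈ w, e ∈ F) ∧ ∃ y ∈ T, x = S.wordMap w y) :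
    T ⊆ S.limitSet F := by
  set T' : Set ℝ := {x | ∃ u : List E, (∀ e ∈ u, e ∈ F) ∧ ∃ y ∈ T, x = S.wordMap u y} with hT'
  have hTT' : T ⊆ T' := fun x hx => ⟨[], by simp, x, hx, rfl⟩
  have hcons : ∀ (e : E) (u : List E), (∀ f ∈ e :: u, f ∈ F) → ∀ y ∈ T,
      ∃ f ∈ F, ∃ z ∈ T', S.wordMap (e :: u) y = S.φ f z := fun e u hu y hy =>
    ⟨e, hu e List.mem_cons_self, S.wordMap u y,
      ⟨u, fun f hf => hu f (List.mem_cons_of_mem _ hf), y, hy, rfl⟩, rfl⟩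
  refine hTT'.trans (S.subset_limitSet ?_ ?_)
  · rintro _ ⟨u, _, y, hy, rfl⟩
    exact S.mapsTo_wordMap u (hTX hy)
  · rintro _ ⟨u, hu, y, hy, rfl⟩
    match u, hu with
    | e :: u, hu => exact hcons e u hu y hy
    | [], _ =>
      obtain ⟨w, hw, hwF, z, hz, rfl⟩ := hT y hy
      match w, hw, hwF with
      | e :: w, _, hwF => exact hcons e w hwF z hz

theorem ordConnected_wordMap_image (w : List E) :
    (S.wordMap w '' interior S.X).OrdConnected := by
  rw [S.interior_X]
  refine (isPreconnected_Ioo.image _ ((S.continuousOn_wordMap w).mono ?_)).ordConnected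
  rw [S.X_eq]
  exact Ioo_subset_Icc_self

theorem wordMap_image_subset_closure (w : List E) :
    S.wordMap w '' S.X ⊆ closure (S.wordMap w '' interior S.X) := by
  have hcl : closure (interior S.X) = S.X := by
    rw [S.interior_X, closure_Ioo S.lo_lt_hi.ne, S.X_eq]
  have h := (S.continuousOn_wordMap w).mono hcl.le
  calc S.wordMap w '' S.X = S.wordMap w '' closure (interior S.X) := by rw [hcl]
    _ ⊆ _ := h.image_closure

theorem eq_of_lo_mem {u v : List E} (hl : u.length = v.length)
    (hu : S.lo ∈ S.wordMap u '' S.X) (hv : S.lo ∈ S.wordMap v '' S.X) : u = v := by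
  have hmid : (S.lo + S.hi) / 2 ∈ interior S.X := by
    rw [S.interior_X]
    constructor <;> linarith [S.lo_lt_hi]
  have key : ∀ w : List E, S.lo ∈ S.wordMap w '' S.X →
      ∃ p, S.lo < p ∧ Ioc S.lo p ⊆ S.wordMap w '' interior S.X := by
    intro w hw
    have hp := S.mapsTo_wordMap_interior w hmid
    rw [S.interior_X] at hp
    refine ⟨_, hp.1, fun q hq => ?_⟩
    obtain ⟨q', hq', hmem⟩ := mem_closure_iff.1 (S.wordMap_image_subset_closure w hw) (Iio q)
      isOpen_Iio hq.1
    exact (S.ordConnected_wordMap_image w).out hmem ⟨_, hmid, rfl⟩ ⟨le_of_lt hq', hq.2⟩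
  by_contra hne
  obtain ⟨p, hp, hpu⟩ := key u hu
  obtain ⟨r, hr, hpv⟩ := key v hv
  exact Set.disjoint_left.1 (S.disjoint_wordMap_image u v hl hne)
    (hpu ⟨lt_min hp hr, min_le_left _ _⟩) (hpv ⟨lt_min hp hr, min_le_right _ _⟩)

theorem eq_of_hi_mem {u v : List E} (hl : u.length = v.length)
    (hu : S.hi ∈ S.wordMap u '' S.X) (hv : S.hi ∈ S.wordMap v '' S.X) : u = v := by
  have hmid : (S.lo + S.hi) / 2 ∈ interior S.X := by
    rw [S.interior_X]
    constructor <;> linarith [S.lo_lt_hi]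
  have key : ∀ w : List E, S.hi ∈ S.wordMap w '' S.X →
      ∃ p, p < S.hi ∧ Ico p S.hi ⊆ S.wordMap w '' interior S.X := by
    intro w hw
    have hp := S.mapsTo_wordMap_interior w hmid
    rw [S.interior_X] at hp
    refine ⟨_, hp.2, fun q hq => ?_⟩
    obtain ⟨q', hq', hmem⟩ := mem_closure_iff.1 (S.wordMap_image_subset_closure w hw) (Ioi q)
      isOpen_Ioi hq.2
    exact (S.ordConnected_wordMap_image w).out ⟨_, hmid, rfl⟩ hmem ⟨hq.1, le_of_lt hq'⟩
  by_contra hne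
  obtain ⟨p, hp, hpu⟩ := key u hu
  obtain ⟨r, hr, hpv⟩ := key v hv
  exact Set.disjoint_left.1 (S.disjoint_wordMap_image u v hl hne)
    (hpu ⟨le_max_left _ _, max_lt hp hr⟩) (hpv ⟨le_max_right _ _, max_lt hp hr⟩)

/-- If `λ_F(t) > 1`, some word over `F` maps `X` into its interior. -/
theorem exists_mapsTo_interior {F : Set E} {t : ℝ} (ht : 0 ≤ t) (h : 1 < S.lam F t) :
    ∃ v : List E, (∀ e ∈ v, e ∈ F) ∧ MapsTo (S.wordMap v) S.X (interior S.X) := by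
  classical
  obtain ⟨n, -, hZ⟩ := S.exists_lt_Z h (C := 2) ENNReal.ofNat_ne_top
  rw [Z_eq, ENNReal.tsum_eq_iSup_sum, lt_iSup_iff] at hZ
  obtain ⟨A, hA⟩ := hZ
  have hcard : 2 < A.card := by
    have h1 : ∑ w ∈ A, S.weight t w ≤ A.card := by
      simpa using Finset.sum_le_card_nsmul A (fun w => S.weight t w) 1
        fun w _ => S.weight_le_one ht w.1
    exact_mod_cast hA.trans_le h1
  obtain ⟨v, hlo, hhi⟩ : ∃ v : Words F n,
      S.lo ∉ S.wordMap v '' S.X ∧ S.hi ∉ S.wordMap v '' S.X := by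
    by_contra! hall
    have h1 : (A.filter fun w : Words F n => S.lo ∈ S.wordMap w '' S.X).card ≤ 1 :=
      Finset.card_le_one.2 fun u hu v hv => Subtype.ext (S.eq_of_lo_mem
        (u.2.1.trans v.2.1.symm) (Finset.mem_filter.1 hu).2 (Finset.mem_filter.1 hv).2)
    have h2 : (A.filter fun w : Words F n => ¬ S.lo ∈ S.wordMap w '' S.X).card ≤ 1 :=
      Finset.card_le_one.2 fun u hu v hv => Subtype.ext (S.eq_of_hi_mem
        (u.2.1.trans v.2.1.symm) (hall u (Finset.mem_filter.1 hu).2)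
        (hall v (Finset.mem_filter.1 hv).2))
    have h3 := Finset.card_filter_add_card_filter_not (s := A)
      fun w : Words F n => S.lo ∈ S.wordMap w '' S.X
    omega
  refine ⟨v.1, v.2.2, fun x hx => ?_⟩
  have hmem := S.mapsTo_wordMap v.1 hx
  rw [S.X_eq] at hmem
  rw [S.interior_X]
  exact ⟨lt_of_le_of_ne hmem.1 fun e => hlo ⟨x, hx, e.symm⟩,
    lt_of_le_of_ne hmem.2 fun e => hhi ⟨x, hx, e⟩⟩

theorem isCompact_X : IsCompact S.X := by
  rw [S.X_eq]
  exact isCompact_Icc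

theorem exists_pos_le_abs_sub {s t : Set ℝ} (hs : IsCompact s) (ht : IsCompact t)
    (hst : Disjoint s t) : ∃ δ : ℝ, 0 < δ ∧ ∀ x ∈ s, ∀ y ∈ t, δ ≤ |x - y| := by
  obtain ⟨r, hr, h⟩ := Metric.exists_pos_forall_lt_edist hs ht.isClosed hst
  refine ⟨r, hr, fun x hx y hy => ?_⟩
  have := (h x hx y hy).le
  rw [edist_nndist] at this
  exact_mod_cast this

/-- The lower half of Bowen's formula. -/
theorem le_dimH_limitSet {F : Set E} {t : ℝ} (ht : 0 < t) (h : 1 < S.lam F t) :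
    ENNReal.ofReal t ≤ dimH (S.limitSet F) := by
  classical
  obtain ⟨v, hvF, hv⟩ := S.exists_mapsTo_interior ht.le h
  set k := ENNReal.ofReal (S.K ^ t) with hk
  have hk0 : k ≠ 0 := (zero_lt_one.trans_le (S.one_le_ofReal_K_rpow ht.le)).ne'
  have hkt : k ≠ ∞ := ENNReal.ofReal_ne_top
  have hv0 := S.weight_ne_zero t v
  obtain ⟨n, hn, hZ⟩ := S.exists_lt_Z h (C := k * k / S.weight t v)
    (ENNReal.div_ne_top (ENNReal.mul_ne_top hkt hkt) hv0)
  rw [Z_eq, ENNReal.tsum_eq_iSup_sum, lt_iSup_iff] at hZ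
  obtain ⟨A, hA⟩ := hZ
  set c : A → ℝ := fun w => S.K⁻¹ * S.wnorm (w.1.1 ++ v) with hc
  have hc0 : ∀ w, 0 < c w := fun w => mul_pos (inv_pos.2 S.K_pos) (S.wnorm_pos _)
  have hwlen : ∀ w : A, (w.1.1 ++ v).length ≠ 0 := fun w => by
    have := w.1.2.1
    simp only [List.length_append]
    omega
  have hc1 : ∀ w, c w < 1 := fun w =>
    calc c w ≤ 1 * S.wnorm (w.1.1 ++ v) :=
          mul_le_mul_of_nonneg_right (inv_le_one_of_one_le₀ S.one_le_K) (S.wnorm_nonneg _)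
      _ ≤ S.s ^ (w.1.1 ++ v).length := by rw [one_mul]; exact S.wnorm_le_pow _
      _ < 1 := pow_lt_one₀ S.hs0 S.hs1 (hwlen w)
  have hsum : 1 ≤ ∑ w, c w ^ t := by
    have h1 : ∀ w : A, S.weight t w.1.1 * S.weight t v ≤ k * k * ENNReal.ofReal (c w ^ t) := by
      intro w
      refine (S.weight_mul_le ht.le w.1.1 v).trans_eq ?_
      rw [mul_assoc]
      congr 1
      rw [hk, ← ENNReal.ofReal_mul (Real.rpow_nonneg S.K_pos.le t),
        Real.mul_rpow (inv_nonneg.2 S.K_pos.le) (S.wnorm_nonneg _), Real.inv_rpow S.K_pos.le,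
        mul_inv_cancel_left₀ (Real.rpow_pos_of_pos S.K_pos t).ne']
      rfl
    have h2 : k * k < (∑ w ∈ A, S.weight t w) * S.weight t v := by
      rwa [ENNReal.div_lt_iff (.inl hv0) (.inl (S.weight_ne_top t v))] at hA
    have h3 : k * k * 1 ≤ k * k * ENNReal.ofReal (∑ w, c w ^ t) := by
      rw [mul_one, ENNReal.ofReal_sum_of_nonneg fun w _ => (Real.rpow_pos_of_pos (hc0 w) t).le,
        Finset.mul_sum]
      refine h2.le.trans ?_
      rw [← Finset.sum_coe_sort A, Finset.sum_mul]
      exact Finset.sum_le_sum fun w _ => h1 w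
    have h4 := (ENNReal.mul_le_mul_iff_right (mul_ne_zero hk0 hk0) (ENNReal.mul_ne_top hkt hkt)).1 h3
    exact ENNReal.one_le_ofReal.1 h4
  obtain ⟨δ, hδ, hsep⟩ : ∃ δ : ℝ, 0 < δ ∧ ∀ u w : A, u ≠ w → ∀ x ∈ S.X, ∀ y ∈ S.X,
      δ ≤ |S.wordMap (u.1.1 ++ v) x - S.wordMap (w.1.1 ++ v) y| := by
    have hcomp : ∀ w : A, IsCompact (S.wordMap (w.1.1 ++ v) '' S.X) := fun w =>
      S.isCompact_X.image_of_continuousOn (S.continuousOn_wordMap _)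
    have hpair : ∀ p : A × A, ∃ δ : ℝ, 0 < δ ∧ (p.1 ≠ p.2 → ∀ x ∈ S.X, ∀ y ∈ S.X,
        δ ≤ |S.wordMap (p.1.1.1 ++ v) x - S.wordMap (p.2.1.1 ++ v) y|) := by
      rintro ⟨u, w⟩
      by_cases huw : u = w
      · exact ⟨1, one_pos, fun h => absurd huw h⟩
      have hdisj : Disjoint (S.wordMap (u.1.1 ++ v) '' S.X) (S.wordMap (w.1.1 ++ v) '' S.X) := by
        have hsub : ∀ u : List E,
            S.wordMap (u ++ v) '' S.X ⊆ S.wordMap u '' interior S.X := by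
          rintro u _ ⟨x, hx, rfl⟩
          rw [wordMap_append]
          exact ⟨_, hv hx, rfl⟩
        exact (S.disjoint_wordMap_image u.1.1 w.1.1 (u.1.2.1.trans w.1.2.1.symm)
          fun h => huw (Subtype.ext (Subtype.ext h))).mono (hsub _) (hsub _)
      obtain ⟨δ, hδ, hle⟩ := exists_pos_le_abs_sub (hcomp u) (hcomp w) hdisj
      exact ⟨δ, hδ, fun _ x hx y hy => hle _ ⟨x, hx, rfl⟩ _ ⟨y, hy, rfl⟩⟩
    choose d hd hdle using hpair
    obtain ⟨δ, hδ, hmin⟩ : ∃ δ : ℝ, 0 < δ ∧ ∀ p, δ ≤ d p := by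
      rcases isEmpty_or_nonempty (A × A) with hE | hE
      · exact ⟨1, one_pos, fun p => hE.elim p⟩
      · obtain ⟨p, hp⟩ := Finite.exists_min d
        exact ⟨d p, hd p, hp⟩
    exact ⟨δ, hδ, fun u w huw x hx y hy => (hmin (u, w)).trans (hdle (u, w) huw x hx y hy)⟩
  obtain ⟨T, hTX, hdim, hT⟩ := exists_invariant_le_dimH S.isCompact_X.isClosed S.lo_mem
    (fun x hx y hy => S.abs_sub_le hx hy) (fun w : A => S.wordMap (w.1.1 ++ v))
    (fun w => S.mapsTo_wordMap _) S.hs0 S.hs1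
    (fun w x hx y hy => (S.abs_wordMap_sub_le_pow _ hx hy).trans
      (mul_le_mul_of_nonneg_right (pow_le_of_le_one S.hs0 S.hs1.le (hwlen w)) (abs_nonneg _)))
    c hc0 hc1 (fun w x hx y hy => S.le_abs_wordMap_sub _ hx hy) hδ hsep ht hsum
  refine hdim.trans (dimH_mono (S.subset_limitSet_of_words hTX fun x hx => ?_))
  obtain ⟨w, y, hy, e⟩ := hT x hx
  refine ⟨w.1.1 ++ v, fun h0 => hwlen w (by rw [h0]; rfl), fun e he => ?_, y, hy, e⟩
  exact (List.mem_append.1 he).elim (w.1.2.2 e) (hvF e)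

theorem finite_le_wnorm_singleton {ε : ℝ} (hε : 0 < ε) : {e : E | ε ≤ S.wnorm [e]}.Finite := by
  have hD : 0 < S.hi - S.lo := sub_pos.2 S.lo_lt_hi
  have hc : 0 < S.K⁻¹ * ε * (S.hi - S.lo) := mul_pos (mul_pos (inv_pos.2 S.K_pos) hε) hD
  have hvol : ∀ e, ENNReal.ofReal (S.K⁻¹ * S.wnorm [e] * (S.hi - S.lo)) ≤
      volume (S.wordMap [e] '' interior S.X) := by
    intro e
    have hcont : ContinuousOn (S.wordMap [e]) (Icc S.lo S.hi) := S.X_eq ▸ S.continuousOn_wordMap [e]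
    have h1 := S.le_abs_wordMap_sub [e] S.hi_mem S.lo_mem
    rw [abs_of_pos hD] at h1
    refine (ENNReal.ofReal_le_ofReal h1).trans ?_
    rw [S.interior_X]
    rcases le_total (S.wordMap [e] S.lo) (S.wordMap [e] S.hi) with hle | hle
    · rw [abs_of_nonneg (sub_nonneg.2 hle), ← Real.volume_Ioo]
      exact measure_mono (intermediate_value_Ioo S.lo_lt_hi.le hcont)
    · rw [abs_of_nonpos (sub_nonpos.2 hle), neg_sub, ← Real.volume_Ioo]
      exact measure_mono (intermediate_value_Ioo' S.lo_lt_hi.le hcont)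
  have hfin := Measure.finite_const_le_meas_of_disjoint_iUnion volume
    (ENNReal.ofReal_pos.2 hc) (As := fun e => S.wordMap [e] '' interior S.X)
    (fun e => (S.ordConnected_wordMap_image [e]).measurableSet) (fun e f hef => S.osc e f hef) ?_
  · refine hfin.subset fun e (he : ε ≤ S.wnorm [e]) => ?_
    refine le_trans (ENNReal.ofReal_le_ofReal ?_) (hvol e)
    exact mul_le_mul_of_nonneg_right (mul_le_mul_of_nonneg_left he (inv_pos.2 S.K_pos).le) hD.le
  · refine ne_top_of_le_ne_top S.isCompact_X.measure_ne_top (measure_mono (iUnion_subset ?_))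
    rintro e _ ⟨x, hx, rfl⟩
    exact S.mapsTo_wordMap [e] (interior_subset hx)

theorem finite_lt_weight_mul {t : ℝ} (ht : 0 < t) {C : ℝ≥0∞} (hC : C ≠ ∞) :
    {e : E | 1 < S.weight t [e] * C}.Finite := by
  have hC1 : 0 < C.toReal + 1 := by positivity
  refine (S.finite_le_wnorm_singleton
    (Real.rpow_pos_of_pos (inv_pos.2 hC1) t⁻¹)).subset
    fun e (he : 1 < S.weight t [e] * C) => ?_
  by_contra hlt
  have hle : S.wnorm [e] ≤ _ := le_of_not_ge hlt
  have h1 := Real.rpow_le_rpow (S.wnorm_nonneg [e]) hle ht.le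
  rw [← Real.rpow_mul (inv_pos.2 hC1).le, inv_mul_cancel₀ ht.ne', Real.rpow_one] at h1
  refine absurd he (not_lt.2 ?_)
  rw [weight, ← ENNReal.ofReal_toReal hC,
    ← ENNReal.ofReal_mul (Real.rpow_nonneg (S.wnorm_nonneg _) t), ENNReal.ofReal_le_one]
  calc S.wnorm [e] ^ t * C.toReal ≤ (C.toReal + 1)⁻¹ * (C.toReal + 1) := by
        gcongr
        linarith
    _ = 1 := inv_mul_cancel₀ hC1.ne'

end CIFS

namespace CIFS

theorem limitSet_empty {E : Type*} (S : CIFS E) : S.limitSet ∅ = ∅ :=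
  eq_empty_of_forall_notMem fun _ ⟨_, hω, _⟩ => hω 0

open scoped Classical in
/-- Greedily adjoin the letters `1, 2, …` as long as `λ(t)` does not exceed `1`; this is the set of
letters chosen among the first `n`. -/
noncomputable def greedy (S : CIFS ℕ+) (t : ℝ) : ℕ → Set ℕ+
  | 0 => ∅
  | n + 1 =>
    if S.lam (greedy S t n ∪ {n.succPNat}) t ≤ 1 then greedy S t n ∪ {n.succPNat}
    else greedy S t n

variable (S : CIFS ℕ+) {t : ℝ}

theorem greedy_succ_of_le {n : ℕ} (h : S.lam (S.greedy t n ∪ {n.succPNat}) t ≤ 1) :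
    S.greedy t (n + 1) = S.greedy t n ∪ {n.succPNat} :=
  if_pos h

theorem greedy_succ_of_not_le {n : ℕ} (h : ¬ S.lam (S.greedy t n ∪ {n.succPNat}) t ≤ 1) :
    S.greedy t (n + 1) = S.greedy t n :=
  if_neg h

theorem monotone_greedy : Monotone (S.greedy t) := by
  refine monotone_nat_of_le_succ fun n => ?_
  by_cases h : S.lam (S.greedy t n ∪ {n.succPNat}) t ≤ 1
  · exact (S.greedy_succ_of_le h).symm ▸ subset_union_left
  · exact (S.greedy_succ_of_not_le h).ge

theorem greedy_subset_Iio (n : ℕ) : S.greedy t n ⊆ Iio n.succPNat := by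
  induction n with
  | zero => exact empty_subset _
  | succ n ih =>
    have hlt : n.succPNat < (n + 1).succPNat := Nat.succPNat_lt_succPNat.2 n.lt_succ_self
    have hsub : S.greedy t n ⊆ Iio (n + 1).succPNat := ih.trans (Iio_subset_Iio hlt.le)
    by_cases h : S.lam (S.greedy t n ∪ {n.succPNat}) t ≤ 1
    · rw [S.greedy_succ_of_le h]
      exact union_subset hsub (singleton_subset_iff.2 hlt)
    · rwa [S.greedy_succ_of_not_le h]

theorem lam_empty_le_one (ht : 0 < t) : S.lam ∅ t ≤ 1 := by
  by_contra! h
  have := S.le_dimH_limitSet ht h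
  rw [limitSet_empty, dimH_empty] at this
  exact absurd ht (not_lt.2 (ENNReal.ofReal_eq_zero.1 (le_zero_iff.1 this)))

theorem lam_greedy_le_one (ht : 0 < t) (n : ℕ) : S.lam (S.greedy t n) t ≤ 1 := by
  induction n with
  | zero => exact S.lam_empty_le_one ht
  | succ n ih =>
    by_cases h : S.lam (S.greedy t n ∪ {n.succPNat}) t ≤ 1
    · rwa [S.greedy_succ_of_le h]
    · rwa [S.greedy_succ_of_not_le h]

theorem lam_iUnion_greedy_le_one (ht : 0 < t) : S.lam (⋃ n, S.greedy t n) t ≤ 1 := by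
  by_contra! h
  obtain ⟨G, hG, hfin, hlam⟩ := S.exists_finite_one_lt_lam ht.le h
  lift G to Finset ℕ+ using hfin
  obtain ⟨n, hn⟩ := S.monotone_greedy.directed_le.exists_mem_subset_of_finset_subset_biUnion hG
  exact absurd (hlam.trans_le (S.lam_mono hn t)) (not_lt.2 (S.lam_greedy_le_one ht n))

theorem succPNat_Ioi (n : ℕ) : Ioi n.succPNat = Ici (n + 1).succPNat := by
  ext b
  simp [← PNat.coe_lt_coe, ← PNat.coe_le_coe]

theorem insert_succPNat_Ici (n : ℕ) :
    {n.succPNat} ∪ Ici (n + 1).succPNat = Ici n.succPNat := by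
  rw [← succPNat_Ioi, singleton_union, Ioi_insert]

theorem one_lt_lam_greedy_union_Ici
    (h : ∀ b : ℕ+, ∀ F ⊆ Iio b, S.lam (F ∪ {b}) t ≤ S.lam (F ∪ Ioi b) t)
    (h1 : 1 < S.lam univ t) (n : ℕ) : 1 < S.lam (S.greedy t n ∪ Ici n.succPNat) t := by
  induction n with
  | zero =>
    convert h1 using 2
    exact eq_univ_of_forall fun b => .inr (show 1 ≤ b from one_le)
  | succ n ih =>
    by_cases hn : S.lam (S.greedy t n ∪ {n.succPNat}) t ≤ 1
    · rwa [S.greedy_succ_of_le hn, union_assoc, insert_succPNat_Ici]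
    · rw [S.greedy_succ_of_not_le hn, ← succPNat_Ioi]
      exact (not_le.1 hn).trans_le (h _ _ (S.greedy_subset_Iio n))

theorem one_le_lam_iUnion_greedy (ht : 0 < t)
    (h : ∀ b : ℕ+, ∀ F ⊆ Iio b, S.lam (F ∪ {b}) t ≤ S.lam (F ∪ Ioi b) t)
    (h1 : 1 < S.lam univ t) : 1 ≤ S.lam (⋃ n, S.greedy t n) t := by
  by_contra! hlt
  set F := ⋃ n, S.greedy t n with hF
  obtain ⟨N, hN⟩ := (S.finite_lt_weight_mul ht (S.tsum_Z_ne_top ht.le hlt)).bddAbove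
  have hmem : ∀ b, N < b → b ∈ F := by
    intro b hb
    obtain ⟨n, rfl⟩ : ∃ n : ℕ, n.succPNat = b := ⟨b.natPred, PNat.succPNat_natPred b⟩
    have hle := S.lam_union_singleton_le_one ht.le hlt
      (not_lt.1 fun hgt => absurd (hN hgt) (not_le.2 hb))
    have hle' : S.lam (S.greedy t n ∪ {n.succPNat}) t ≤ 1 :=
      (S.lam_mono (union_subset_union_left _ (subset_iUnion (S.greedy t) n)) t).trans hle
    refine mem_iUnion.2 ⟨n + 1, ?_⟩
    rw [S.greedy_succ_of_le hle']
    exact .inr rfl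
  refine absurd ((S.one_lt_lam_greedy_union_Ici h h1 N).trans_le (S.lam_mono ?_ t)) hlt.not_gt
  refine union_subset (subset_iUnion (S.greedy t) N) fun b hb => hmem b (lt_of_lt_of_le ?_ hb)
  rw [← PNat.coe_lt_coe, Nat.succPNat_coe]
  exact Nat.lt_succ_self _

theorem dimH_limitSet_iUnion_greedy (ht : 0 < t)
    (h : ∀ b : ℕ+, ∀ F ⊆ Iio b, S.lam (F ∪ {b}) t ≤ S.lam (F ∪ Ioi b) t)
    (h1 : 1 < S.lam univ t) : dimH (S.limitSet (⋃ n, S.greedy t n)) = ENNReal.ofReal t := by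
  refine le_antisymm (S.dimH_limitSet_le ht.le (S.lam_iUnion_greedy_le_one ht)) ?_
  have hlim : Tendsto (fun u : ℝ => ENNReal.ofReal u) (𝓝[<] t) (𝓝 (ENNReal.ofReal t)) :=
    (ENNReal.continuous_ofReal.tendsto t).mono_left nhdsWithin_le_nhds
  refine le_of_tendsto hlim (mem_of_superset (Ioo_mem_nhdsLT ht) fun u hu => ?_)
  refine S.le_dimH_limitSet hu.1 (not_le.1 fun hle => ?_)
  exact absurd (S.lam_lt_one_of_lt hu.2 hle) (not_lt.2 (S.one_le_lam_iUnion_greedy ht h h1))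

end CIFS

end

/-- Theorem 4.4 (Kesseböhmer–Zhu criterion): let `Φ = {φ_e}_{e ∈ ℕ⁺}` be a CIFS indexed by
the natural numbers `{1, 2, 3, …}`. If for every `b`, every `F ⊆ {1, …, b−1}` and every
`0 < t ≤ dim_H(J_ℕ)` one has `λ_{F∪{b}}(t) ≤ λ_{F∪L_b}(t)` where `L_b = {b+1, b+2, …}`,
then `Φ` has full Hausdorff dimension spectrum. -/
theorem CIFS.full_spectrum_criterion (S : CIFS ℕ+)
    (h : ∀ b : ℕ+, ∀ F : Set ℕ+, F ⊆ Set.Iio b → ∀ t : ℝ, 0 < t →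
      ENNReal.ofReal t ≤ dimH (S.limitSet Set.univ) →
      S.lam (F ∪ {b}) t ≤ S.lam (F ∪ Set.Ioi b) t) :
    ∀ t : ℝ, 0 ≤ t → ENNReal.ofReal t ≤ dimH (S.limitSet Set.univ) →
      ∃ F : Set ℕ+, dimH (S.limitSet F) = ENNReal.ofReal t := by
  intro t ht hdim
  rcases hdim.eq_or_lt with heq | hlt
  · exact ⟨Set.univ, heq.symm⟩
  rcases ht.eq_or_lt with rfl | ht
  · exact ⟨∅, by rw [S.limitSet_empty, dimH_empty, ENNReal.ofReal_zero]⟩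
  exact ⟨_, S.dimH_limitSet_iUnion_greedy ht (fun b F hF => h b F hF t ht hdim)
    (not_le.1 fun hle => hlt.not_ge (S.dimH_limitSet_le ht.le hle))⟩
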